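/- (Concatenation.) Let Ω₀ be a nonempty open convex subset of ℝ² that does not contain any line, let Ω₁ be an open convex subset of ℝ² with cl Ω₁ ⊆ Ω₀, set Ω = cl Ω₀ \ Ω₁, and assume Ω satisfies conditions (1) and (3). Let (φ_k)_k be a sequence of functions on an interval I belonging to A_Ω such that the convex hull of {⟨φ_k⟩_I}_k is a bounded subset of Ω, and let (α_k)_k be non-negative numbers with Σ_k α_k = 1. Then there exists a function φ ∈ A_Ω whose distribution μ_φ equals Σ_k α_k μ_{φ_k}. -/

import Mathlib

open Set MeasureTheory
open scoped ENNReal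

noncomputable section

/-- `Euc d` is the Euclidean space `ℝ^d`. -/
abbrev Euc (d : ℕ) := EuclideanSpace ℝ (Fin d)

/-- The set `s` contains no (full) line. -/
def ContainsNoLine (s : Set (Euc 2)) : Prop :=
  ¬ ∃ x v : Euc 2, v ≠ 0 ∧ ∀ t : ℝ, x + t • v ∈ s

/-- The boundary of `s` contains no nondegenerate line segment. -/
def NoSegBoundary (s : Set (Euc 2)) : Prop :=
  ¬ ∃ y z : Euc 2, y ≠ z ∧ segment ℝ y z ⊆ frontier s

/-- Condition (1): neither `∂Ω₀` nor `∂Ω₁` contains a line segment. -/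
def Cond1 (Ω₀ Ω₁ : Set (Euc 2)) : Prop := NoSegBoundary Ω₀ ∧ NoSegBoundary Ω₁

/-- The boundary of `s` is a `C²`-smooth curve: near each of its points it admits a regular
`C²` parametrization. -/
def C2SmoothBoundary (s : Set (Euc 2)) : Prop :=
  ∀ x ∈ frontier s, ∃ (ε : ℝ) (γ : ℝ → Euc 2), 0 < ε ∧ ContDiff ℝ 2 γ ∧
    (∀ t : ℝ, deriv γ t ≠ 0) ∧ γ 0 = x ∧ γ '' Ioo (-ε) ε = frontier s ∩ Metric.ball x ε

/-- Condition (3): `Ω₀` is unbounded and every ray contained in `Ω₀` can be translated so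
as to lie entirely inside `Ω₁`. -/
def Cond3 (Ω₀ Ω₁ : Set (Euc 2)) : Prop :=
  (¬ Bornology.IsBounded Ω₀) ∧
  ∀ x v : Euc 2, v ≠ 0 → (∀ t : ℝ, 0 ≤ t → x + t • v ∈ Ω₀) →
    ∃ y : Euc 2, ∀ t : ℝ, 0 ≤ t → y + t • v ∈ Ω₁

/-- The class `A_Ω` on the interval `[a, b]`: summable functions with values in `∂Ω₀`
whose average over every subinterval stays out of `Ω₁`. -/
def classA (Ω₀ Ω₁ : Set (Euc 2)) (a b : ℝ) (φ : ℝ → Euc 2) : Prop :=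
  MeasureTheory.IntegrableOn φ (Set.Icc a b) ∧
  (∀ t ∈ Set.Icc a b, φ t ∈ frontier Ω₀) ∧
  ∀ c e : ℝ, a ≤ c → c < e → e ≤ b → (⨍ t in Set.Icc c e, φ t ∂volume) ∉ Ω₁

/-- `Ω̃₁` determines an extension `cl Ω₀ \ Ω̃₁` of `Ω = cl Ω₀ \ Ω₁`. -/
def IsExtension (Ω₀ Ω₁ Ωt₁ : Set (Euc 2)) : Prop :=
  IsOpen Ωt₁ ∧ Convex ℝ Ωt₁ ∧ closure Ωt₁ ⊆ Ω₁ ∧ Cond1 Ω₀ Ωt₁ ∧ Cond3 Ω₀ Ωt₁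

theorem open_comps (U : Set ℝ) (hU : IsOpen U) (a b : ℝ) (hab : U ⊆ Ioo a b) :
    ∃ (ι : Type) (_ : Countable ι) (c d : ι → ℝ), (∀ i, c i < d i) ∧ (∀ i, a ≤ c i) ∧
      (∀ i, d i ≤ b) ∧ (∀ i, c i ∉ U) ∧ (∀ i, d i ∉ U) ∧
      Pairwise (Function.onFun Disjoint (fun i => Ioo (c i) (d i))) ∧
      U = ⋃ i, Ioo (c i) (d i) := by
  let ι := {P : ℝ × ℝ // P.1 < P.2 ∧ Ioo P.1 P.2 ⊆ U ∧ P.1 ∉ U ∧ P.2 ∉ U}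
  have hd : Pairwise (Function.onFun Disjoint (fun i : ι => Ioo i.1.1 i.1.2)) := by
    rintro ⟨⟨c, d⟩, h1, h2, h3, h4⟩ ⟨⟨c', d'⟩, h1', h2', h3', h4'⟩ hne
    rw [Function.onFun, Set.disjoint_left]
    rintro x ⟨hx1, hx2⟩ ⟨hx3, hx4⟩
    simp only at *
    apply hne
    have e1 : c = c' := by
      rcases lt_trichotomy c c' with h | h | h
      · exact absurd (h2 ⟨h, by linarith⟩) h3'
      · exact h
      · exact absurd (h2' ⟨h, by linarith⟩) h3
    have e2 : d = d' := by
      rcases lt_trichotomy d d' with h | h | h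
      · exact absurd (h2' ⟨by linarith, h⟩) h4
      · exact h
      · exact absurd (h2 ⟨by linarith, h⟩) h4'
    simp [e1, e2]
  have hcount : Countable ι := hd.countable_of_isOpen_disjoint (fun i => isOpen_Ioo)
    (fun i => nonempty_Ioo.2 i.2.1)
  have hends : ∀ c d : ℝ, c < d → Ioo c d ⊆ U → a ≤ c ∧ d ≤ b := by
    intro c d hcd hs
    have := (Ioo_subset_Ioo_iff hcd).1 (hs.trans hab)
    exact this
  refine ⟨ι, hcount, fun i => i.1.1, fun i => i.1.2, fun i => i.2.1,
    fun i => (hends _ _ i.2.1 i.2.2.1).1, fun i => (hends _ _ i.2.1 i.2.2.1).2,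
    fun i => i.2.2.2.1, fun i => i.2.2.2.2, hd, ?_⟩
  apply Subset.antisymm
  · intro x hx
    have hxab := hab hx
    have hcl : IsClosed Uᶜ := hU.isClosed_compl
    have haU : a ∉ U := fun h => lt_irrefl _ (hab h).1
    have hbU : b ∉ U := fun h => lt_irrefl _ (hab h).2
    have hc := (hcl.inter isClosed_Iic).csSup_mem (s := Uᶜ ∩ Iic x) ⟨a, haU, hxab.1.le⟩
      ⟨x, fun y hy => hy.2⟩
    have hd' := (hcl.inter isClosed_Ici).csInf_mem (s := Uᶜ ∩ Ici x) ⟨b, hbU, hxab.2.le⟩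
      ⟨x, fun y hy => hy.2⟩
    set c := sSup (Uᶜ ∩ Iic x) with hcdef
    set d := sInf (Uᶜ ∩ Ici x) with hddef
    have hcx : c < x := lt_of_le_of_ne hc.2 (fun h => hc.1 (h ▸ hx))
    have hxd : x < d := lt_of_le_of_ne hd'.2 (fun h => hd'.1 (h ▸ hx))
    refine mem_iUnion.2 ⟨⟨(c, d), hcx.trans hxd, ?_, hc.1, hd'.1⟩, hcx, hxd⟩
    rintro y ⟨hy1, hy2⟩
    simp only at hy1 hy2
    by_contra hy
    rcases le_total y x with h | h
    · exact not_le.2 hy1 (le_csSup (s := Uᶜ ∩ Iic x) ⟨x, fun y hy => hy.2⟩ ⟨hy, h⟩)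
    · exact not_le.2 hy2 (csInf_le (s := Uᶜ ∩ Ici x) ⟨x, fun y hy => hy.2⟩ ⟨hy, h⟩)
  · exact iUnion_subset fun i => i.2.2.1

theorem rising_sun (g h H : ℝ → ℝ) (hg : IntervalIntegrable g volume 0 1)
    (hh : IntervalIntegrable h volume 0 1) (hH : IntervalIntegrable H volume 0 1)
    (hint : ∀ c e : ℝ, 0 ≤ c → c < e → e ≤ 1 → ∫ t in c..e, g t = 0 → ∫ t in c..e, h t ≤ 0)
    (htot : ∫ t in (0:ℝ)..1, g t ≤ 0)
    (hHh : ∀ t ∈ Icc (0:ℝ) 1, H t ≤ h t) (hHg : ∀ t ∈ Icc (0:ℝ) 1, g t ≤ 0 → H t ≤ 0) :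
    ∫ t in (0:ℝ)..1, H t ≤ 0 := by
  have sub : ∀ {f : ℝ → ℝ}, IntervalIntegrable f volume 0 1 → ∀ {c e : ℝ}, 0 ≤ c → c ≤ e → e ≤ 1 →
      IntervalIntegrable f volume c e := by
    intro f hf c e hc hce he
    apply hf.mono_set
    rw [uIcc_of_le hce, uIcc_of_le zero_le_one]
    exact Icc_subset_Icc hc he
  set F : ℝ → ℝ := fun x => ∫ t in (0:ℝ)..x, g t with hF
  have hFc : ContinuousOn F (Icc 0 1) := by
    have := intervalIntegral.continuousOn_primitive_interval' hg (left_mem_uIcc)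
    rwa [uIcc_of_le zero_le_one] at this
  have hFsub : ∀ {c e : ℝ}, 0 ≤ c → c ≤ e → e ≤ 1 → ∫ t in c..e, g t = F e - F c := by
    intro c e hc hce he
    rw [hF]
    simp only
    rw [intervalIntegral.integral_interval_sub_left]
    · exact sub hg le_rfl (hc.trans hce) he
    · exact sub hg le_rfl hc (hce.trans he)
  have hF0 : F 0 = 0 := by simp [hF]
  -- last zero
  have hZc : IsClosed (Icc (0:ℝ) 1 ∩ F ⁻¹' {0}) := hFc.preimage_isClosed_of_isClosed isClosed_Icc isClosed_singleton
  have hbdd : BddAbove (Icc (0:ℝ) 1 ∩ F ⁻¹' {0}) := ⟨1, fun y hy => hy.1.2⟩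
  have hx1 := hZc.csSup_mem (s := Icc (0:ℝ) 1 ∩ F ⁻¹' {0}) ⟨0, ⟨le_rfl, zero_le_one⟩, hF0⟩ hbdd
  set a := sSup (Icc (0:ℝ) 1 ∩ F ⁻¹' {0}) with ha
  obtain ⟨⟨ha0, ha1⟩, hFa⟩ := hx1
  have hFa : F a = 0 := hFa
  have hmax : ∀ y ∈ Icc a 1, F y ≤ 0 := by
    intro y hy
    by_contra hpos
    push Not at hpos
    have h0 : (0:ℝ) ∈ Icc (F 1) (F y) := ⟨htot, hpos.le⟩
    obtain ⟨z, hz, hz0⟩ := intermediate_value_Icc' hy.2 (hFc.mono (Icc_subset_Icc (ha0.trans hy.1) le_rfl)) h0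
    have hza : z ≤ a := le_csSup hbdd ⟨⟨ha0.trans (hy.1.trans hz.1), hz.2⟩, hz0⟩
    have : y = a := le_antisymm (hz.1.trans hza) hy.1
    rw [this, hFa] at hpos
    exact lt_irrefl _ hpos
  rw [← intervalIntegral.integral_add_adjacent_intervals (sub hH le_rfl ha0 ha1) (sub hH ha0 ha1 le_rfl)]
  have p1 : ∫ t in (0:ℝ)..a, H t ≤ 0 := by
    rcases eq_or_lt_of_le ha0 with h | h
    · rw [← h]; simp
    · refine (intervalIntegral.integral_mono_on ha0 (sub hH le_rfl ha0 ha1) (sub hh le_rfl ha0 ha1)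
        (fun x hx => hHh x ⟨hx.1, hx.2.trans ha1⟩)).trans (hint 0 a le_rfl h ha1 hFa)
  have p2 : ∫ t in a..1, H t ≤ 0 := by
    set U : Set ℝ := {x | x ∈ Ioo a 1 ∧ ∃ y ∈ Ioc x 1, F x < F y} with hU
    have hUsub : U ⊆ Ioo a 1 := fun x hx => hx.1
    have hFat : ∀ x ∈ Ioo a 1, ContinuousAt F x := fun x hx =>
      hFc.continuousAt (Icc_mem_nhds (ha0.trans_lt hx.1) hx.2)
    have hUo : IsOpen U := by
      rw [isOpen_iff_mem_nhds]
      rintro x ⟨hx, y, hy, hxy⟩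
      filter_upwards [isOpen_Ioo.mem_nhds hx, (hFat x hx).eventually_lt_const hxy,
        Iio_mem_nhds hy.1] with z hz1 hz2 hz3
      exact ⟨hz1, y, ⟨hz3, hy.2⟩, hz2⟩
    obtain ⟨ι, hι, c, d, hcd, hac, hdb, hcU, hdU, hdis, hUeq⟩ := open_comps U hUo a 1 hUsub
    have hIH : IntegrableOn H (Ioc a 1) := (intervalIntegrable_iff_integrableOn_Ioc_of_le ha1).1 (sub hH ha0 ha1 le_rfl)
    have hIh : IntegrableOn h (Ioc a 1) := (intervalIntegrable_iff_integrableOn_Ioc_of_le ha1).1 (sub hh ha0 ha1 le_rfl)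
    have hUsub' : U ⊆ Ioc a 1 := hUsub.trans Ioo_subset_Ioc_self
    have hcomp : ∀ i, F (c i) = F (d i) := by
      intro i
      have hIcc : Icc (c i) (d i) ⊆ Icc 0 1 := Icc_subset_Icc (ha0.trans (hac i)) (hdb i)
      have key : ∀ x ∈ Ioo (c i) (d i), F x ≤ F (d i) := by
        intro x hx
        have hx1 : x ≤ 1 := hx.2.le.trans (hdb i)
        have hx0 : 0 ≤ x := (ha0.trans (hac i)).trans hx.1.le
        obtain ⟨y, hy, hymax⟩ := isCompact_Icc.exists_isMaxOn (nonempty_Icc.2 hx1)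
          (hFc.mono (Icc_subset_Icc hx0 le_rfl))
        have hxy : F x ≤ F y := hymax ⟨le_rfl, hx1⟩
        refine hxy.trans ?_
        rcases lt_trichotomy y (d i) with hlt | heq | hgt
        · have hyU : y ∈ U := by
            rw [hUeq]; exact mem_iUnion.2 ⟨i, hx.1.trans_le hy.1, hlt⟩
          obtain ⟨-, z, hz, hyz⟩ := hyU
          exact absurd (hymax (a := z) ⟨hy.1.trans hz.1.le, hz.2⟩) (not_le.2 hyz)
        · rw [heq]
        · by_contra hcon
          exact hdU i ⟨⟨(hac i).trans_lt (hcd i), hgt.trans_le hy.2⟩, y, ⟨hgt, hy.2⟩, not_le.1 hcon⟩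
      apply le_antisymm
      · have hcw : ContinuousWithinAt F (Ioo (c i) (d i)) (c i) :=
          (hFc _ (hIcc (left_mem_Icc.2 (hcd i).le))).mono (Ioo_subset_Icc_self.trans hIcc)
        have : (nhdsWithin (c i) (Ioo (c i) (d i))).NeBot := left_nhdsWithin_Ioo_neBot (hcd i)
        exact le_of_tendsto hcw (eventually_nhdsWithin_of_forall key)
      · rcases eq_or_lt_of_le (hac i) with h | h
        · rw [← h, hFa]
          exact hmax _ ⟨(hac i).trans (hcd i).le, hdb i⟩
        · by_contra hcon
          exact hcU i ⟨⟨h, (hcd i).trans_le (hdb i)⟩, d i, ⟨hcd i, hdb i⟩, not_le.1 hcon⟩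
    have hUint : ∫ t in U, h t ≤ 0 := by
      have hs := hasSum_integral_iUnion (μ := volume) (f := h) (fun i => measurableSet_Ioo (a := c i) (b := d i)) hdis
        (by rw [← hUeq]; exact hIh.mono_set hUsub')
      rw [← hUeq] at hs
      refine hs.nonpos fun i => ?_
      rw [← integral_Ioc_eq_integral_Ioo, ← intervalIntegral.integral_of_le (hcd i).le]
      apply hint _ _ (ha0.trans (hac i)) (hcd i) (hdb i)
      rw [hFsub (ha0.trans (hac i)) (hcd i).le (hdb i), hcomp i, sub_self]
    rw [intervalIntegral.integral_of_le ha1,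
      ← integral_inter_add_sdiff hUo.measurableSet hIH]
    have e1 : Ioc a 1 ∩ U = U := inter_eq_right.2 hUsub'
    rw [e1]
    have q1 : ∫ t in U, H t ≤ 0 := by
      refine le_trans (setIntegral_mono_on (hIH.mono_set hUsub') (hIh.mono_set hUsub') hUo.measurableSet ?_) hUint
      intro x hx
      exact hHh x ⟨ha0.trans (hUsub hx).1.le, (hUsub hx).2.le⟩
    have q2 : ∫ t in Ioc a 1 \ U, H t ≤ 0 := by
      apply setIntegral_nonpos_of_ae_restrict
      have hae := hg.ae_hasDerivAt_integral
      rw [uIcc_of_le zero_le_one] at hae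
      have hne : ∀ᵐ x : ℝ, x ≠ 1 := by simp [ae_iff, measure_singleton]
      rw [Filter.EventuallyLE, ae_restrict_iff' (measurableSet_Ioc.diff hUo.measurableSet)]
      filter_upwards [hae, hne] with x hx hx1 hxm
      have hxI : x ∈ Icc (0:ℝ) 1 := ⟨ha0.trans hxm.1.1.le, hxm.1.2⟩
      have hxlt : x < 1 := lt_of_le_of_ne hxm.1.2 hx1
      have hder : HasDerivAt F (g x) x := hx hxI 0 ⟨le_rfl, zero_le_one⟩
      apply hHg x hxI
      have hle : ∀ y ∈ Ioc x 1, F y ≤ F x := by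
        intro y hy
        by_contra hcon
        exact hxm.2 ⟨⟨hxm.1.1, hxlt⟩, y, hy, not_le.1 hcon⟩
      have ht : Filter.Tendsto (slope F x) (nhdsWithin x (Ioi x)) (nhds (g x)) :=
        (hasDerivAt_iff_tendsto_slope.1 hder).mono_left (nhdsWithin_mono _ (fun y hy => ne_of_gt hy))
      refine le_of_tendsto ht ?_
      filter_upwards [Ioc_mem_nhdsGT hxlt] with y hy
      rw [slope_def_field]
      exact div_nonpos_of_nonpos_of_nonneg (by linarith [hle y hy]) (by linarith [hy.1])
    linarith
  linarith


structure Geo (Ω₀ Ω₁ : Set (Euc 2)) (p q : Euc 2 →L[ℝ] ℝ) (v w : Euc 2) : Prop where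
  pv : p v = 0
  qv : q v = 1
  dec : ∀ z, z = p z • w + q z • v
  rec1 : ∀ x ∈ Ω₁, ∀ t : ℝ, 0 ≤ t → x + t • v ∈ Ω₁
  low : ∀ z ∈ frontier Ω₀, ∀ y ∈ closure Ω₀, p z = p y → q z ≤ q y
  ord : ∀ z ∈ frontier Ω₀, ∀ y ∈ frontier Ω₀, ∀ r, p z ≤ r → r ≤ p y → ∃ u ∈ frontier Ω₀, p u = r

theorem Geo.neg {Ω₀ Ω₁ : Set (Euc 2)} {p q : Euc 2 →L[ℝ] ℝ} {v w : Euc 2} (h : Geo Ω₀ Ω₁ p q v w) :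
    Geo Ω₀ Ω₁ (-p) q v (-w) where
  pv := by simp [h.pv]
  qv := h.qv
  dec := fun z => by simpa using h.dec z
  rec1 := h.rec1
  low := fun z hz y hy e => h.low z hz y hy (by simpa using e)
  ord := fun z hz y hy r h1 h2 => by
    simp only [neg_apply] at h1 h2 ⊢
    obtain ⟨u, hu, e⟩ := h.ord y hy z hz (-r) (by linarith) (by linarith)
    exact ⟨u, hu, by linarith⟩

theorem Geo.eq {Ω₀ Ω₁ : Set (Euc 2)} {p q : Euc 2 →L[ℝ] ℝ} {v w : Euc 2} (h : Geo Ω₀ Ω₁ p q v w)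
    {z y : Euc 2} (hp : p z = p y) (hq : q z = q y) : z = y := by
  rw [h.dec z, h.dec y, hp, hq]

theorem Geo.inj {Ω₀ Ω₁ : Set (Euc 2)} {p q : Euc 2 →L[ℝ] ℝ} {v w : Euc 2} (h : Geo Ω₀ Ω₁ p q v w)
    {z y : Euc 2} (hz : z ∈ frontier Ω₀) (hy : y ∈ frontier Ω₀) (hp : p z = p y) : z = y :=
  h.eq hp (le_antisymm (h.low z hz y hy.1 hp) (h.low y hy z hz.1 hp.symm))

theorem exists_geo (Ω₀ Ω₁ : Set (Euc 2)) (h0ne : Ω₀.Nonempty) (h0open : IsOpen Ω₀)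
    (h0conv : Convex ℝ Ω₀) (h0line : ContainsNoLine Ω₀)
    (h1open : IsOpen Ω₁) (h1conv : Convex ℝ Ω₁)
    (h1 : Cond1 Ω₀ Ω₁) (h3 : Cond3 Ω₀ Ω₁) :
    ∃ p q v w, Geo Ω₀ Ω₁ p q v w := by
  obtain ⟨v, hv0, hv⟩ := not_bounded_iff_exists_ne_zero_mem_asymptoticCone.1 h3.1
  have rec0 : ∀ x ∈ Ω₀, ∀ t : ℝ, 0 ≤ t → x + t • v ∈ Ω₀ := by
    intro x hx t ht
    have := h0conv.smul_vadd_mem_of_mem_nhds_of_mem_asymptoticCone ht (h0open.mem_nhds hx) hv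
    rwa [vadd_eq_add, add_comm] at this
  obtain ⟨x0, hx0⟩ := h0ne
  obtain ⟨y1, hy1⟩ := h3.2 x0 v hv0 (rec0 x0 hx0)
  have hv1 : v ∈ asymptoticCone ℝ Ω₁ := by
    rw [mem_asymptoticCone_iff]
    refine Filter.tendsto_id.atTop_smul_const_tendsto_asymptoticNhds v
      |>.asymptoticNhds_vadd_const y1 |>.frequently (Filter.Eventually.frequently ?_)
    filter_upwards [Filter.eventually_ge_atTop (0:ℝ)] with t ht
    rw [vadd_eq_add, add_comm]
    exact hy1 t ht
  have rec1 : ∀ x ∈ Ω₁, ∀ t : ℝ, 0 ≤ t → x + t • v ∈ Ω₁ := by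
    intro x hx t ht
    have := h1conv.smul_vadd_mem_of_mem_nhds_of_mem_asymptoticCone ht (h1open.mem_nhds hx) hv1
    rwa [vadd_eq_add, add_comm] at this
  set n : ℝ := v 0 ^ 2 + v 1 ^ 2 with hn
  have hn0 : n ≠ 0 := by
    intro h
    apply hv0
    have a0 : v 0 = 0 := by nlinarith [sq_nonneg (v 0), sq_nonneg (v 1)]
    have a1 : v 1 = 0 := by nlinarith [sq_nonneg (v 0), sq_nonneg (v 1)]
    ext i; fin_cases i <;> simp [a0, a1]
  let P0 : Euc 2 →L[ℝ] ℝ := EuclideanSpace.proj 0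
  let P1 : Euc 2 →L[ℝ] ℝ := EuclideanSpace.proj 1
  let p : Euc 2 →L[ℝ] ℝ := (v 1 / n) • P0 - (v 0 / n) • P1
  let q : Euc 2 →L[ℝ] ℝ := (v 0 / n) • P0 + (v 1 / n) • P1
  let w : Euc 2 := !₂[v 1, - v 0]
  have hp : ∀ z, p z = (v 1 / n) * z 0 - (v 0 / n) * z 1 := fun z => by simp [p, P0, P1]
  have hq : ∀ z, q z = (v 0 / n) * z 0 + (v 1 / n) * z 1 := fun z => by simp [q, P0, P1]
  have pv : p v = 0 := by rw [hp]; ring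
  have qv : q v = 1 := by rw [hq]; field_simp; rw [hn]
  have dec : ∀ z, z = p z • w + q z • v := by
    intro z
    rw [hp, hq]
    ext i; fin_cases i
    · simp [w]; field_simp; rw [hn]; ring
    · simp [w]; field_simp; rw [hn]; ring
  have hfr : frontier Ω₀ = closure Ω₀ \ Ω₀ := h0open.frontier_eq
  refine ⟨p, q, v, w, pv, qv, dec, rec1, ?_, ?_⟩
  · intro z hz y hy hpe
    by_contra hlt
    push Not at hlt
    set τ := q z - q y with hτ
    have hτ0 : 0 < τ := sub_pos.2 hlt
    have hzy : z = y + τ • v := by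
      conv_lhs => rw [dec z]
      conv_rhs => rw [dec y, hpe.symm, hτ]
      module
    rw [hfr] at hz
    apply h1.1
    refine ⟨y, z, fun h => by rw [h] at hlt; exact lt_irrefl _ hlt, ?_⟩
    intro u hu
    rw [hfr]
    refine ⟨h0conv.closure.segment_subset hy hz.1 hu, fun hu0 => hz.2 ?_⟩
    obtain ⟨a, b, ha, hb, hab, rfl⟩ := hu
    have := rec0 _ hu0 (a * τ) (by positivity)
    convert this using 1
    rw [hzy, show a = 1 - b by linarith]
    module
  · intro z hz y hy r hr1 hr2
    have hm : ∃ m ∈ closure Ω₀, p m = r := by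
      have hcc : r ∈ p '' (segment ℝ z y) := by
        have himg : p '' segment ℝ z y = segment ℝ (p z) (p y) := by
          simpa using image_segment ℝ (p : Euc 2 →ₗ[ℝ] ℝ).toAffineMap z y
        rw [himg, segment_eq_Icc (hr1.trans hr2)]
        exact ⟨hr1, hr2⟩
      obtain ⟨m, hm, e⟩ := hcc
      exact ⟨m, h0conv.closure.segment_subset hz.1 hy.1 hm, e⟩
    obtain ⟨m, hm, e⟩ := hm
    by_cases hm0 : m ∈ Ω₀
    · let c : ℝ → Euc 2 := fun t => m + t • v
      have hc : Continuous c := by fun_prop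
      have hne : (frontier (c ⁻¹' Ω₀)).Nonempty := by
        rw [nonempty_frontier_iff]
        refine ⟨⟨0, by simpa [c] using hm0⟩, fun h => h0line ⟨m, v, hv0, fun t => ?_⟩⟩
        have : t ∈ c ⁻¹' Ω₀ := by rw [h]; trivial
        exact this
      obtain ⟨t, ht⟩ := hne
      refine ⟨c t, hc.frontier_preimage_subset _ ht, ?_⟩
      simp [c, pv, e]
    · exact ⟨m, by rw [hfr]; exact ⟨hm, hm0⟩, e⟩

/-- two independent functionals bounded above on the domain control the norm -/
theorem exists_ctrl (Ω₀ : Set (Euc 2)) (h0ne : Ω₀.Nonempty) (h0open : IsOpen Ω₀)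
    (h0conv : Convex ℝ Ω₀) (h0line : ContainsNoLine Ω₀) :
    ∃ (l : Euc 2 →L[ℝ] ℝ) (C K : ℝ), 0 ≤ K ∧ ∀ z ∈ closure Ω₀, ‖z‖ ≤ K * (C - l z) := by
  obtain ⟨x, hx⟩ := h0ne
  have key : ∀ v : Euc 2, v ≠ 0 → ∃ (l : Euc 2 →L[ℝ] ℝ) (C : ℝ), l v ≠ 0 ∧ ∀ z ∈ closure Ω₀, l z ≤ C := by
    intro v hv
    have : ∃ t : ℝ, x + t • v ∉ Ω₀ := by
      by_contra h
      push Not at h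
      exact h0line ⟨x, v, hv, h⟩
    obtain ⟨t, ht⟩ := this
    obtain ⟨f, hf⟩ := geometric_hahn_banach_open_point h0conv h0open ht
    refine ⟨f, f (x + t • v), fun h => ?_, fun z hz => ?_⟩
    · have := hf x hx
      simp [h] at this
    · have : closure Ω₀ ⊆ {z | f z ≤ f (x + t • v)} :=
        closure_minimal (fun a ha => (hf a ha).le) (isClosed_le f.continuous continuous_const)
      exact this hz
  obtain ⟨l1, C1, hl1, hC1⟩ := key !₂[1, 0] (by intro h; have := congrArg (fun z : Euc 2 => z 0) h; simp at this)
  set e0 : Euc 2 := !₂[1, 0] with he0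
  set e1 : Euc 2 := !₂[0, 1] with he1
  have hdec : ∀ z : Euc 2, z = z 0 • e0 + z 1 • e1 := by
    intro z; ext i; fin_cases i <;> simp [he0, he1]
  set u : Euc 2 := !₂[- l1 e1, l1 e0] with hu
  have hu1 : l1 u = 0 := by
    rw [hdec u]; simp [hu]; ring
  obtain ⟨l2, C2, hl2, hC2⟩ := key u (by
    intro h; have := congrArg (fun z : Euc 2 => z 1) h; simp [hu] at this; exact hl1 this)
  let T : Euc 2 →ₗ[ℝ] ℝ × ℝ := (l1 : Euc 2 →ₗ[ℝ] ℝ).prod (l2 : Euc 2 →ₗ[ℝ] ℝ)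
  have hT : LinearMap.ker T = ⊥ := by
    rw [LinearMap.ker_eq_bot']
    intro z hz
    have z1 : l1 z = 0 := congrArg Prod.fst hz
    have z2 : l2 z = 0 := congrArg Prod.snd hz
    have a1 : z 0 * l1 e0 + z 1 * l1 e1 = 0 := by
      have := z1; rw [hdec z] at this; simpa using this
    have hz' : l1 e0 • z = z 1 • u := by
      ext i; fin_cases i
      · simp [hu]; linarith
      · simp [hu]; ring
    have := congrArg l2 hz'
    simp [z2, hl2] at this
    rw [this] at hz'
    simpa [hl1] using hz'
  obtain ⟨K, hK0, hK⟩ := T.exists_antilipschitzWith hT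
  refine ⟨l1 + l2, |C1| + |C2| + C1 + C2, K, K.2, fun z hz => ?_⟩
  have h1 := hK.le_mul_dist z 0
  rw [map_zero, dist_zero_right, dist_zero_right] at h1
  refine h1.trans (mul_le_mul_of_nonneg_left ?_ K.2)
  have h2 : ‖T z‖ ≤ |l1 z| + |l2 z| := by
    change max ‖l1 z‖ ‖l2 z‖ ≤ _
    simp only [Real.norm_eq_abs]
    exact max_le (by linarith [abs_nonneg (l2 z)]) (by linarith [abs_nonneg (l1 z)])
  have h3 : |l1 z| ≤ |C1| + (C1 - l1 z) := by
    have := abs_sub_abs_le_abs_sub (l1 z) C1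
    rw [abs_sub_comm, abs_of_nonneg (sub_nonneg.2 (hC1 z hz))] at this
    linarith
  have h4 : |l2 z| ≤ |C2| + (C2 - l2 z) := by
    have := abs_sub_abs_le_abs_sub (l2 z) C2
    rw [abs_sub_comm, abs_of_nonneg (sub_nonneg.2 (hC2 z hz))] at this
    linarith
  simp only [add_apply]
  linarith


theorem exists_quantile (ν : Measure ℝ) [IsProbabilityMeasure ν] :
    ∃ Q : ℝ → ℝ, Measurable Q ∧ MonotoneOn Q (Ioo 0 1) ∧
      Measure.map Q (volume.restrict (Ioo (0:ℝ) 1)) = ν ∧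
      (∀ u ∈ Ioo (0:ℝ) 1, 0 < ν (Iic (Q u))) ∧ (∀ u ∈ Ioo (0:ℝ) 1, ν (Iio (Q u)) < 1) := by
  set F := ProbabilityTheory.cdf ν with hF
  have hmono : Monotone F := ProbabilityTheory.monotone_cdf ν
  let Q0 : ℝ → ℝ := fun u => sInf {x | u ≤ F x}
  have gal : ∀ u ∈ Ioo (0:ℝ) 1, ∀ x, Q0 u ≤ x ↔ u ≤ F x := by
    intro u hu x
    have hne : {x | u ≤ F x}.Nonempty := by
      have := ((ProbabilityTheory.tendsto_cdf_atTop ν).eventually_const_lt hu.2).exists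
      obtain ⟨y, hy⟩ := this
      exact ⟨y, hy.le⟩
    have hbd : BddBelow {x | u ≤ F x} := by
      obtain ⟨y, hy⟩ := ((ProbabilityTheory.tendsto_cdf_atBot ν).eventually_lt_const hu.1).exists
      refine ⟨y, fun z hz => ?_⟩
      by_contra h
      exact absurd (hz.trans (hmono (not_le.1 h).le)) (not_le.2 hy)
    have hmem : u ≤ F (Q0 u) := by
      have hrc : Filter.Tendsto F (nhdsWithin (Q0 u) (Ioi (Q0 u))) (nhds (F (Q0 u))) :=
        (F.right_continuous (Q0 u)).mono_left (nhdsWithin_mono _ Ioi_subset_Ici_self)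
      refine ge_of_tendsto hrc (eventually_nhdsWithin_of_forall fun y hy => ?_)
      obtain ⟨z, hz, hzy⟩ := exists_lt_of_csInf_lt hne hy
      exact le_trans hz (hmono hzy.le)
    exact ⟨fun h => hmem.trans (hmono h), fun h => csInf_le hbd h⟩
  let Q : ℝ → ℝ := fun u => if u ∈ Ioo (0:ℝ) 1 then Q0 u else 0
  have hQ : ∀ u ∈ Ioo (0:ℝ) 1, Q u = Q0 u := fun u hu => if_pos hu
  have hQm : Measurable Q := by
    refine measurable_of_Iic fun x => ?_
    have : Q ⁻¹' Iic x = (Ioo 0 1 ∩ Iic (F x)) ∪ ((Ioo (0:ℝ) 1)ᶜ ∩ {_u | (0:ℝ) ≤ x}) := by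
      ext u
      by_cases hu : u ∈ Ioo (0:ℝ) 1
      · simp only [mem_preimage, mem_Iic, hQ u hu, gal u hu, mem_union, mem_inter_iff, hu, true_and,
          mem_compl_iff, not_true, false_and, or_false]
      · simp only [mem_preimage, mem_Iic, mem_union, mem_inter_iff, hu, false_and,
          mem_compl_iff, not_false_iff, true_and, false_or, Q, if_false, mem_ofPred_eq]
    rw [this]
    exact (measurableSet_Ioo.inter measurableSet_Iic).union
      (measurableSet_Ioo.compl.inter (MeasurableSet.const _))
  have hle : ∀ u ∈ Ioo (0:ℝ) 1, u ≤ F (Q u) := fun u hu => by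
    rw [hQ u hu]; exact (gal u hu _).1 le_rfl
  refine ⟨Q, hQm, ?_, ?_, ?_, ?_⟩
  · intro a ha b hb hab
    rw [hQ a ha, hQ b hb, gal a ha]
    exact hab.trans ((gal b hb _).1 le_rfl)
  · have : IsProbabilityMeasure (volume.restrict (Ioo (0:ℝ) 1)) := ⟨by simp⟩
    have : IsProbabilityMeasure (Measure.map Q (volume.restrict (Ioo (0:ℝ) 1))) :=
      Measure.isProbabilityMeasure_map hQm.aemeasurable
    refine Measure.ext_of_Iic _ _ fun x => ?_
    rw [Measure.map_apply hQm measurableSet_Iic, Measure.restrict_apply (hQm measurableSet_Iic),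
      ← ProbabilityTheory.ofReal_cdf ν x]
    have e1 : Q ⁻¹' Iic x ∩ Ioo 0 1 = Ioo 0 1 ∩ Iic (F x) := by
      ext u
      simp only [mem_inter_iff, mem_preimage, mem_Iic]
      constructor
      · rintro ⟨h1, h2⟩
        exact ⟨h2, (gal u h2 x).1 (by rwa [hQ u h2] at h1)⟩
      · rintro ⟨h1, h2⟩
        exact ⟨by rw [hQ u h1]; exact (gal u h1 x).2 h2, h1⟩
    rw [e1]
    have e2 : (Ioo (0:ℝ) 1 ∩ Iic (F x) : Set ℝ) =ᵐ[volume] (Ioc (0:ℝ) 1 ∩ Iic (F x) : Set ℝ) :=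
      Ioo_ae_eq_Ioc.inter (Filter.EventuallyEq.refl _ _)
    rw [measure_congr e2, Ioc_inter_Iic, Real.volume_Ioc, min_eq_right (ProbabilityTheory.cdf_le_one ν x), sub_zero]
  · intro u hu
    rw [← ProbabilityTheory.ofReal_cdf]
    exact ENNReal.ofReal_pos.2 (hu.1.trans_le (hle u hu))
  · intro u hu
    rw [← ProbabilityTheory.measure_cdf ν, StieltjesFunction.measure_Iio _ (ProbabilityTheory.tendsto_cdf_atBot ν)]
    have : Function.leftLim F (Q u) ≤ u := by
      refine le_of_tendsto (hmono.tendsto_leftLim (Q u)) (eventually_nhdsWithin_of_forall fun y hy => ?_)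
      by_contra h
      have h2 := (gal u hu y).2 (not_le.1 h).le
      rw [← hQ u hu] at h2
      exact absurd h2 (not_le.2 hy)
    rw [sub_zero, ENNReal.ofReal_lt_one]
    exact this.trans_lt hu.2

theorem exists_rearr {Ω₀ Ω₁ : Set (Euc 2)} {p q : Euc 2 →L[ℝ] ℝ} {v w : Euc 2}
    (G : Geo Ω₀ Ω₁ p q v w) (μ : Measure (Euc 2)) [IsProbabilityMeasure μ]
    (hμ : ∀ᵐ z ∂μ, z ∈ frontier Ω₀) :
    ∃ ψ : ℝ → Euc 2, Measurable ψ ∧ (∀ t, ψ t ∈ frontier Ω₀) ∧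
      MonotoneOn (fun t => p (ψ t)) (Ioo 0 1) ∧
      Measure.map ψ (volume.restrict (Icc (0:ℝ) 1)) = μ := by
  have hpm : Measurable p := p.continuous.measurable
  have : IsProbabilityMeasure (Measure.map p μ) := Measure.isProbabilityMeasure_map hpm.aemeasurable
  obtain ⟨Q, hQm, hQmono, hQmap, hQ1, hQ2⟩ := exists_quantile (Measure.map p μ)
  obtain ⟨s0, hs0⟩ : ∃ s0, s0 ∈ frontier Ω₀ := hμ.exists
  have hmem : ∀ u ∈ Ioo (0:ℝ) 1, ∃ z ∈ frontier Ω₀, p z = Q u := by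
    intro u hu
    have a1 : ∃ z ∈ frontier Ω₀, p z ≤ Q u := by
      by_contra h
      push Not at h
      have := hQ1 u hu
      rw [Measure.map_apply hpm measurableSet_Iic] at this
      refine this.ne' ?_
      rw [← nonpos_iff_eq_zero]
      refine le_trans (measure_mono ?_) (le_of_eq (ae_iff.1 hμ))
      intro z hz hzf
      exact absurd hz (not_le.2 (h z hzf))
    have a2 : ∃ z ∈ frontier Ω₀, Q u ≤ p z := by
      by_contra h
      push Not at h
      have := hQ2 u hu
      rw [Measure.map_apply hpm measurableSet_Iio] at this
      refine this.ne ?_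
      rw [← mem_ae_iff_prob_eq_one (hpm measurableSet_Iio)]
      filter_upwards [hμ] with z hz
      exact h z hz
    obtain ⟨z, hz, hz'⟩ := a1
    obtain ⟨y, hy, hy'⟩ := a2
    exact G.ord z hz y hy _ hz' hy'
  have hemb := ContinuousOn.measurableEmbedding (f := p) (s := frontier Ω₀) isClosed_frontier.measurableSet
    p.continuous.continuousOn (fun a ha b hb e => G.inj ha hb e)
  obtain ⟨g, hgm, hg⟩ := hemb.exists_measurable_extend (g := Subtype.val) measurable_subtype_coe (fun _ => ⟨s0⟩)
  have hg' : ∀ z ∈ frontier Ω₀, g (p z) = z := fun z hz => congrFun hg ⟨z, hz⟩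
  refine ⟨fun u => if u ∈ Ioo (0:ℝ) 1 then g (Q u) else s0, ?_, ?_, ?_, ?_⟩
  · exact Measurable.ite measurableSet_Ioo (hgm.comp hQm) measurable_const
  · intro u
    by_cases hu : u ∈ Ioo (0:ℝ) 1
    · obtain ⟨z, hz, e⟩ := hmem u hu
      simp only [hu, if_true, ← e, hg' z hz]
      exact hz
    · simp only [hu, if_false]
      exact hs0
  · intro a ha b hb hab
    obtain ⟨z, hz, e⟩ := hmem a ha
    obtain ⟨y, hy, e'⟩ := hmem b hb
    have := hQmono ha hb hab
    simp only [ha, hb, if_true, ← e, ← e', hg' z hz, hg' y hy]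
    rwa [e, e']
  · rw [← Measure.restrict_congr_set (Ioo_ae_eq_Icc (μ := volume) (a := (0:ℝ)) (b := 1))]
    have e1 : Measure.map (fun u => if u ∈ Ioo (0:ℝ) 1 then g (Q u) else s0) (volume.restrict (Ioo (0:ℝ) 1))
        = Measure.map (g ∘ Q) (volume.restrict (Ioo (0:ℝ) 1)) := by
      apply Measure.map_congr
      filter_upwards [ae_restrict_mem measurableSet_Ioo] with u hu
      simp [hu.1, hu.2]
    rw [e1, ← Measure.map_map hgm hQm, hQmap, Measure.map_map hgm hpm]
    have e2 : Measure.map (g ∘ p) μ = Measure.map id μ := by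
      apply Measure.map_congr
      filter_upwards [hμ] with z hz
      exact hg' z hz
    rw [e2, Measure.map_id]


theorem Geo.tri {Ω₀ Ω₁ : Set (Euc 2)} {p q : Euc 2 →L[ℝ] ℝ} {v w : Euc 2} (G : Geo Ω₀ Ω₁ p q v w)
    (h0conv : Convex ℝ Ω₀) {z1 z2 z3 : Euc 2} (h1 : z1 ∈ closure Ω₀) (h2 : z2 ∈ frontier Ω₀)
    (h3 : z3 ∈ closure Ω₀) (h12 : p z1 ≤ p z2) (h23 : p z2 ≤ p z3) (h13 : p z1 < p z3) :
    (p z3 - p z1) * q z2 ≤ (p z3 - p z2) * q z1 + (p z2 - p z1) * q z3 := by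
  have hD : 0 < p z3 - p z1 := sub_pos.2 h13
  have hm : ((p z3 - p z2) / (p z3 - p z1)) • z1 + ((p z2 - p z1) / (p z3 - p z1)) • z3 ∈ closure Ω₀ :=
    h0conv.closure h1 h3 (div_nonneg (by linarith) hD.le) (div_nonneg (by linarith) hD.le)
      (by field_simp; ring)
  have hl := G.low z2 h2 _ hm (by simp; field_simp; ring)
  simp only [map_add, map_smul, smul_eq_mul] at hl
  have := mul_le_mul_of_nonneg_left hl hD.le
  refine this.trans (le_of_eq ?_)
  field_simp

theorem Geo.mem1 {Ω₀ Ω₁ : Set (Euc 2)} {p q : Euc 2 →L[ℝ] ℝ} {v w : Euc 2} (G : Geo Ω₀ Ω₁ p q v w)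
    {b z : Euc 2} (hb : b ∈ Ω₁) (hp : p z = p b) (hq : q b ≤ q z) : z ∈ Ω₁ := by
  have := G.rec1 b hb (q z - q b) (by linarith)
  convert this using 1
  apply G.eq
  · simp [G.pv, hp]
  · simp [G.qv]

theorem clm_avg (l : Euc 2 →L[ℝ] ℝ) (φ : ℝ → Euc 2) {c e : ℝ} (hce : c < e)
    (hφ : IntegrableOn φ (Icc c e)) :
    ∫ t in c..e, l (φ t) = (e - c) * l (⨍ t in Icc c e, φ t) := by
  rw [setAverage_eq, map_smul, intervalIntegral.integral_of_le hce.le, ← integral_Icc_eq_integral_Ioc,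
    ← ContinuousLinearMap.integral_comp_comm l hφ]
  have : volume.real (Icc c e) = e - c := by simp [Measure.real, Real.volume_Icc, hce.le]
  rw [this, smul_eq_mul, ← mul_assoc, mul_inv_cancel₀ (sub_pos.2 hce).ne', one_mul]

/-- un-normalised chord function through `y` and `b` -/
def chord (p q : Euc 2 →L[ℝ] ℝ) (y b : Euc 2) : Euc 2 →L[ℝ] ℝ :=
  (p b - p y) • q - (q b - q y) • p

theorem chord_apply (p q : Euc 2 →L[ℝ] ℝ) (y b z : Euc 2) :
    chord p q y b z = (p b - p y) * q z - (q b - q y) * p z := by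
  simp [chord]

theorem chord_eq (p q : Euc 2 →L[ℝ] ℝ) (y b : Euc 2) : chord p q y b y = chord p q y b b := by
  simp only [chord_apply]; ring

/-- truncated chord function -/
def tchord (p q : Euc 2 →L[ℝ] ℝ) (y b : Euc 2) (z : Euc 2) : ℝ :=
  {z | p y < p z}.indicator (fun z => chord p q y b z - chord p q y b b) z

theorem tchord_meas (p q : Euc 2 →L[ℝ] ℝ) (y b : Euc 2) : Measurable (tchord p q y b) := by
  unfold tchord
  refine Measurable.indicator ?_ ?_
  · exact ((chord p q y b).continuous.measurable).sub_const _
  · exact measurableSet_lt measurable_const p.continuous.measurable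

theorem tchord_bound (p q : Euc 2 →L[ℝ] ℝ) (y b z : Euc 2) :
    ‖tchord p q y b z‖ ≤ ‖chord p q y b z - chord p q y b b‖ := by
  unfold tchord
  exact norm_indicator_le_norm_self _ _

theorem tchord_integrable {X : Type*} [MeasurableSpace X] (μ : Measure X) [IsFiniteMeasure μ] (φ : X → Euc 2)
    (hφ : Integrable φ μ) (p q : Euc 2 →L[ℝ] ℝ) (y b : Euc 2) :
    Integrable (fun x => tchord p q y b (φ x)) μ := by
  have h1 : Integrable (fun x => chord p q y b (φ x) - chord p q y b b) μ :=
    ((chord p q y b).integrable_comp hφ).sub (integrable_const _)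
  refine h1.mono ?_ (Filter.Eventually.of_forall fun x => tchord_bound p q y b (φ x))
  exact ((tchord_meas p q y b).comp_aemeasurable hφ.1.aemeasurable).aestronglyMeasurable

theorem chord_nonneg_left {Ω₀ Ω₁ : Set (Euc 2)} {p q : Euc 2 →L[ℝ] ℝ} {v w : Euc 2} (G : Geo Ω₀ Ω₁ p q v w)
    (h0conv : Convex ℝ Ω₀) {y b z : Euc 2} (hy : y ∈ frontier Ω₀) (hb : b ∈ closure Ω₀)
    (hyb : p y < p b) (hz : z ∈ frontier Ω₀) (h : p z ≤ p y) :
    0 ≤ chord p q y b z - chord p q y b b := by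
  have := G.tri h0conv hz.1 hy hb h hyb.le (h.trans_lt hyb)
  simp only [chord_apply]
  linarith

theorem chord_nonpos_mid {Ω₀ Ω₁ : Set (Euc 2)} {p q : Euc 2 →L[ℝ] ℝ} {v w : Euc 2} (G : Geo Ω₀ Ω₁ p q v w)
    (h0conv : Convex ℝ Ω₀) {y b z : Euc 2} (hy : y ∈ frontier Ω₀) (hb : b ∈ closure Ω₀)
    (hyb : p y < p b) (hz : z ∈ frontier Ω₀) (h : p y ≤ p z) (h' : p z ≤ p b) :
    chord p q y b z - chord p q y b b ≤ 0 := by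
  have := G.tri h0conv hy.1 hz hb h h' hyb
  simp only [chord_apply]
  linarith

theorem chord_nonneg_right {Ω₀ Ω₁ : Set (Euc 2)} {p q : Euc 2 →L[ℝ] ℝ} {v w : Euc 2} (G : Geo Ω₀ Ω₁ p q v w)
    (h0conv : Convex ℝ Ω₀) {y b z : Euc 2} (hy : y ∈ frontier Ω₀) (hb : b ∈ frontier Ω₀)
    (hyb : p y < p b) (hz : z ∈ frontier Ω₀) (h : p b ≤ p z) :
    0 ≤ chord p q y b z - chord p q y b b := by
  have := G.tri h0conv hy.1 hb hz.1 hyb.le h (hyb.trans_le h)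
  simp only [chord_apply]
  linarith

theorem per_k {Ω₀ Ω₁ : Set (Euc 2)} {p q : Euc 2 →L[ℝ] ℝ} {v w : Euc 2} (G : Geo Ω₀ Ω₁ p q v w)
    (h0conv : Convex ℝ Ω₀) (h1cl : closure Ω₁ ⊆ Ω₀)
    {y b : Euc 2} (hy : y ∈ frontier Ω₀) (hb : b ∈ Ω₁) (hyb : p y < p b)
    (φ : ℝ → Euc 2) (hφ : classA Ω₀ Ω₁ 0 1 φ) :
    (∫ t in Icc (0:ℝ) 1, tchord p q y b (φ t) ≤
      chord p q y b (⨍ t in Icc (0:ℝ) 1, φ t) - chord p q y b b) ∧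
    (p (⨍ t in Icc (0:ℝ) 1, φ t) ≤ p b → ∫ t in Icc (0:ℝ) 1, tchord p q y b (φ t) ≤ 0) := by
  have hbc : b ∈ closure Ω₀ := subset_closure (h1cl (subset_closure hb))
  obtain ⟨hI, hS, hA⟩ := hφ
  have hIH : IntegrableOn (fun t => tchord p q y b (φ t)) (Icc 0 1) :=
    tchord_integrable _ φ hI p q y b
  have hIl : ∀ l : Euc 2 →L[ℝ] ℝ, IntegrableOn (fun t => l (φ t) - l b) (Icc 0 1) := fun l =>
    (l.integrable_comp hI).sub (integrable_const _)
  have toI : ∀ {f : ℝ → ℝ}, IntegrableOn f (Icc 0 1) → IntervalIntegrable f volume 0 1 := fun hf =>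
    (intervalIntegrable_iff_integrableOn_Icc_of_le zero_le_one).2 hf
  have havg : ∀ (l : Euc 2 →L[ℝ] ℝ) (c e : ℝ), 0 ≤ c → c < e → e ≤ 1 →
      ∫ t in c..e, (l (φ t) - l b) = (e - c) * (l (⨍ t in Icc c e, φ t) - l b) := by
    intro l c e hc hce he
    have hsub : IntegrableOn φ (Icc c e) := hI.mono_set (Icc_subset_Icc hc he)
    rw [intervalIntegral.integral_sub, clm_avg l φ hce hsub]
    · simp; ring
    · exact (intervalIntegrable_iff_integrableOn_Icc_of_le hce.le).2 (l.integrable_comp hsub)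
    · simp
  have hle : ∀ t ∈ Icc (0:ℝ) 1, tchord p q y b (φ t) ≤ chord p q y b (φ t) - chord p q y b b := by
    intro t ht
    unfold tchord
    by_cases h : p y < p (φ t)
    · rw [indicator_of_mem (show φ t ∈ {z | p y < p z} from h)]
    · rw [indicator_of_notMem (show φ t ∉ {z | p y < p z} from h)]
      exact chord_nonneg_left G h0conv hy hbc hyb (hS t ht) (not_lt.1 h)
  rw [integral_Icc_eq_integral_Ioc, ← intervalIntegral.integral_of_le zero_le_one]
  constructor
  · have := havg (chord p q y b) 0 1 le_rfl one_pos le_rfl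
    rw [sub_zero, one_mul] at this
    rw [← this]
    exact intervalIntegral.integral_mono_on zero_le_one (toI hIH) (toI (hIl _)) hle
  · intro hpx
    refine rising_sun (fun t => p (φ t) - p b) (fun t => chord p q y b (φ t) - chord p q y b b) _
      (toI (hIl _)) (toI (hIl _)) (toI hIH) ?_ ?_ hle ?_
    · intro c e hc hce he h0
      rw [havg p c e hc hce he] at h0
      have hpe : p (⨍ t in Icc c e, φ t) = p b := by
        rcases mul_eq_zero.1 h0 with h | h <;> linarith
      have hq : q (⨍ t in Icc c e, φ t) < q b := by
        by_contra hcon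
        exact hA c e hc hce he (G.mem1 hb hpe (not_lt.1 hcon))
      rw [havg _ c e hc hce he]
      apply mul_nonpos_of_nonneg_of_nonpos (by linarith)
      simp only [chord_apply, hpe]
      nlinarith
    · rw [havg p 0 1 le_rfl one_pos le_rfl]
      linarith
    · intro t ht hg
      unfold tchord
      by_cases h : p y < p (φ t)
      · rw [indicator_of_mem (show φ t ∈ {z | p y < p z} from h)]
        exact chord_nonpos_mid G h0conv hy hbc hyb (hS t ht) h.le (by linarith)
      · rw [indicator_of_notMem (show φ t ∉ {z | p y < p z} from h)]

theorem sum_arg {Ω₀ Ω₁ : Set (Euc 2)} {p q : Euc 2 →L[ℝ] ℝ} {v w : Euc 2} (G : Geo Ω₀ Ω₁ p q v w)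
    {y b : Euc 2} (hb : b ∈ Ω₁) (hyb : p y < p b)
    (x : ℕ → Euc 2) (c α : ℕ → ℝ) (hα : ∀ k, 0 ≤ α k) (hsum : HasSum α 1)
    (f : Euc 2 →L[ℝ] ℝ) (u : ℝ) (hf1 : ∀ z ∈ Ω₁, f z < u) (hfx : ∀ k, u ≤ f (x k))
    (T C : ℝ) (hT : HasSum (fun k => α k * p (x k)) T) (hTb : T ≤ p b)
    (hC : HasSum (fun k => α k * c k) C)
    (hc1 : ∀ k, c k ≤ chord p q y b (x k) - chord p q y b b)
    (hc2 : ∀ k, p (x k) ≤ p b → c k ≤ 0) : C ≤ 0 := by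
  have hD : 0 < p b - p y := sub_pos.2 hyb
  have hT' : HasSum (fun k => α k * (p (x k) - p b)) (T - p b) := by
    have := hT.sub (hsum.mul_right (p b))
    simpa [mul_sub] using this
  have hallneg : (∀ k, c k ≤ 0) → C ≤ 0 := fun h =>
    hC.nonpos fun k => mul_nonpos_of_nonneg_of_nonpos (hα k) (h k)
  have hfz : ∀ z, f z = p z * f w + q z * f v := by
    intro z; conv_lhs => rw [G.dec z]
    simp
  have hfv : f v ≤ 0 := by
    by_contra h
    push Not at h
    have h2 := hf1 _ (G.rec1 b hb ((u - f b) / f v) (div_nonneg (by linarith [hf1 b hb]) h.le))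
    simp only [map_add, map_smul, smul_eq_mul] at h2
    rw [div_mul_cancel₀ _ h.ne'] at h2
    linarith
  have hfb := hf1 b hb
  have hk : ∀ k, u - f b ≤ (p (x k) - p b) * f w + (q (x k) - q b) * f v := by
    intro k
    have := hfx k
    rw [hfz (x k)] at this
    rw [hfz b]
    linarith
  set A := q b - q y with hA
  set D := p b - p y with hDdef
  have hc1' : ∀ k, c k ≤ D * (q (x k) - q b) - A * (p (x k) - p b) := by
    intro k
    have := hc1 k
    simp only [chord_apply] at this
    linarith
  rcases eq_or_lt_of_le hfv with h0 | hneg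
  · simp only [h0, mul_zero, add_zero] at hk
    rcases le_or_gt (f w) 0 with hw | hw
    · apply hallneg
      intro k
      rcases le_or_gt (p (x k)) (p b) with h | h
      · exact hc2 k h
      · have := hk k
        nlinarith
    · exfalso
      have h2 : HasSum (fun k => α k * (p (x k) - p b) * f w) ((T - p b) * f w) := hT'.mul_right _
      have h3 : HasSum (fun k => α k * (u - f b)) (1 * (u - f b)) := hsum.mul_right _
      have := hasSum_le (fun k => by
        have := mul_le_mul_of_nonneg_left (hk k) (hα k)
        linarith) h3 h2
      nlinarith
  · set B := - f v with hB
    have hB0 : 0 < B := by linarith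
    set J := D * f w - A * B with hJ
    have hBc : ∀ k, B * c k ≤ J * (p (x k) - p b) := by
      intro k
      have h1 := mul_le_mul_of_nonneg_left (hc1' k) hB0.le
      have h2 := mul_le_mul_of_nonneg_left (hk k) hD.le
      have h3 : 0 ≤ D * (u - f b) := by apply mul_nonneg hD.le; linarith
      have h4 : f v = - B := by rw [hB]; ring
      rw [h4] at h2
      rw [hJ]
      nlinarith
    rcases le_or_gt 0 J with hJ0 | hJ0
    · have h2 : HasSum (fun k => B * (α k * c k)) (B * C) := hC.mul_left _
      have h3 : HasSum (fun k => J * (α k * (p (x k) - p b))) (J * (T - p b)) := hT'.mul_left _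
      have := hasSum_le (fun k => by
        have := mul_le_mul_of_nonneg_left (hBc k) (hα k)
        linarith) h2 h3
      by_contra hcon
      push Not at hcon
      nlinarith [mul_pos hB0 hcon]
    · apply hallneg
      intro k
      rcases le_or_gt (p (x k)) (p b) with h | h
      · exact hc2 k h
      · have := hBc k
        by_contra hcon
        push Not at hcon
        nlinarith [mul_pos hB0 hcon]


theorem ii_nonneg {g : ℝ → ℝ} {a b : ℝ} (hab : a ≤ b) (h : ∀ t ∈ Ioo a b, 0 ≤ g t) :
    0 ≤ ∫ t in a..b, g t := by
  rw [intervalIntegral.integral_of_le hab, integral_Ioc_eq_integral_Ioo]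
  exact setIntegral_nonneg measurableSet_Ioo h

theorem ii_congr {g h : ℝ → ℝ} {a b : ℝ} (hab : a ≤ b) (H : ∀ t ∈ Ioo a b, g t = h t) :
    ∫ t in a..b, g t = ∫ t in a..b, h t := by
  rw [intervalIntegral.integral_of_le hab, intervalIntegral.integral_of_le hab,
    integral_Ioc_eq_integral_Ioo, integral_Ioc_eq_integral_Ioo]
  exact setIntegral_congr_fun measurableSet_Ioo H

theorem no_bad {Ω₀ Ω₁ : Set (Euc 2)} {p q : Euc 2 →L[ℝ] ℝ} {v w : Euc 2} (G : Geo Ω₀ Ω₁ p q v w)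
    (h0open : IsOpen Ω₀) (h0conv : Convex ℝ Ω₀) (h1open : IsOpen Ω₁) (h1cl : closure Ω₁ ⊆ Ω₀)
    (ψ : ℝ → Euc 2) (hψ : ∀ t, ψ t ∈ frontier Ω₀)
    (hmono : MonotoneOn (fun t => p (ψ t)) (Ioo 0 1)) (hI : IntegrableOn ψ (Icc 0 1))
    (hD2 : ∀ y ∈ frontier Ω₀, ∀ b ∈ Ω₁, p y < p b → (∫ t in (0:ℝ)..1, p (ψ t)) ≤ p b →
      ∫ t in (0:ℝ)..1, tchord p q y b (ψ t) ≤ 0)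
    (f : Euc 2 →L[ℝ] ℝ) (u : ℝ) (hf1 : ∀ z ∈ Ω₁, f z < u) (hfu : u ≤ ∫ t in (0:ℝ)..1, f (ψ t))
    {c e : ℝ} (hc : 0 < c) (hce : c < e) (he : e < 1)
    (hb : (⨍ t in Icc c e, ψ t) ∈ Ω₁) (hpb : (∫ t in (0:ℝ)..1, p (ψ t)) ≤ p (⨍ t in Icc c e, ψ t)) :
    False := by
  have hne : ∀ z ∈ Ω₁, z ∉ frontier Ω₀ := fun z hz hzf => by
    rw [h0open.frontier_eq] at hzf
    exact hzf.2 (h1cl (subset_closure hz))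
  have toII : ∀ {g : ℝ → ℝ}, IntegrableOn g (Icc 0 1) → ∀ {a b : ℝ}, 0 ≤ a → a ≤ b → b ≤ 1 →
      IntervalIntegrable g volume a b := fun hf a b ha hab hb =>
    (intervalIntegrable_iff_integrableOn_Icc_of_le hab).2 (hf.mono_set (Icc_subset_Icc ha hb))
  have hIl : ∀ (l : Euc 2 →L[ℝ] ℝ) (r : ℝ), IntegrableOn (fun t => l (ψ t) - r) (Icc 0 1) := fun l r =>
    (l.integrable_comp hI).sub (integrable_const _)
  have havg : ∀ (l : Euc 2 →L[ℝ] ℝ) (r : ℝ) (a b : ℝ), 0 ≤ a → a < b → b ≤ 1 →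
      ∫ t in a..b, (l (ψ t) - r) = (b - a) * (l (⨍ t in Icc a b, ψ t) - r) := by
    intro l r c e hc hce he
    have hsub : IntegrableOn ψ (Icc c e) := hI.mono_set (Icc_subset_Icc hc he)
    rw [intervalIntegral.integral_sub, clm_avg l ψ hce hsub]
    · simp; ring
    · exact (intervalIntegrable_iff_integrableOn_Icc_of_le hce.le).2 (l.integrable_comp hsub)
    · simp
  have hconst : ∀ (a b : ℝ), 0 ≤ a → a < b → b ≤ 1 → ∀ y ∈ frontier Ω₀,
      (∀ t ∈ Ioo a b, p (ψ t) = p y) → (⨍ t in Icc a b, ψ t) = y := by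
    intro a b ha hab hb1 y hy hh
    have key : ∀ l : Euc 2 →L[ℝ] ℝ, l (⨍ t in Icc a b, ψ t) = l y := by
      intro l
      have h1 := havg l (l y) a b ha hab hb1
      rw [ii_congr hab.le (h := fun _ => 0) (fun t ht => by
        rw [G.inj (hψ t) hy (hh t ht), sub_self])] at h1
      simp only [intervalIntegral.integral_zero] at h1
      rcases mul_eq_zero.1 h1.symm with h | h <;> linarith
    exact G.eq (key p) (key q)
  set b := ⨍ t in Icc c e, ψ t with hbdef
  have hcI : c ∈ Ioo (0:ℝ) 1 := ⟨hc, hce.trans he⟩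
  have heI : e ∈ Ioo (0:ℝ) 1 := ⟨hc.trans hce, he⟩
  have hpe : p b ≤ p (ψ e) := by
    have h1 := havg p (p (ψ e)) c e hc.le hce he.le
    have h2 : 0 ≤ ∫ t in c..e, -(p (ψ t) - p (ψ e)) := ii_nonneg hce.le fun t ht => by
      have := hmono (show t ∈ Ioo (0:ℝ) 1 from ⟨hc.trans ht.1, ht.2.trans he⟩) heI ht.2.le
      simp only at this
      linarith
    rw [intervalIntegral.integral_neg, h1] at h2
    by_contra hcon
    push Not at hcon
    nlinarith [mul_pos (sub_pos.2 hce) (sub_pos.2 hcon)]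
  have hlt : p (ψ c) < p (ψ e) := by
    rcases lt_or_eq_of_le (show p (ψ c) ≤ p (ψ e) from hmono hcI heI hce.le) with h | h
    · exact h
    · exfalso
      have := hconst c e hc.le hce he.le (ψ e) (hψ e) fun t ht => by
        have htI : t ∈ Ioo (0:ℝ) 1 := ⟨hc.trans ht.1, ht.2.trans he⟩
        have h1 := hmono hcI htI ht.1.le
        have h2 := hmono htI heI ht.2.le
        simp only at h1 h2
        linarith
      rw [← hbdef] at this
      exact hne b hb (this ▸ hψ e)
  -- the left endpoint
  obtain ⟨c', ⟨hc0, hc'c⟩, hN⟩ : ∃ c' ∈ Icc 0 c, ∫ t in c'..1, (p (ψ t) - p b) = 0 := by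
    have hcont : ContinuousOn (fun x => ∫ t in x..1, (p (ψ t) - p b)) (Icc 0 c) := by
      have h := intervalIntegral.continuousOn_primitive_interval_left (a := (0:ℝ)) (b := 1)
        (f := fun t => p (ψ t) - p b) (μ := volume)
        (by rw [uIcc_of_le zero_le_one]; exact hIl p _)
      rw [uIcc_of_le zero_le_one] at h
      exact h.mono (Icc_subset_Icc le_rfl hcI.2.le)
    have := intermediate_value_Icc hc.le hcont
    refine this ⟨?_, ?_⟩
    · show ∫ t in (0:ℝ)..1, (p (ψ t) - p b) ≤ 0
      rw [intervalIntegral.integral_sub (toII (p.integrable_comp hI) le_rfl zero_le_one le_rfl) (by simp)]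
      simp only [intervalIntegral.integral_const, smul_eq_mul]
      linarith
    · show 0 ≤ ∫ t in c..1, (p (ψ t) - p b)
      rw [← intervalIntegral.integral_add_adjacent_intervals (b := e)
        (toII (hIl p _) hc.le hce.le he.le) (toII (hIl p _) heI.1.le he.le le_rfl),
        havg p (p b) c e hc.le hce he.le, ← hbdef, sub_self, mul_zero, zero_add]
      refine ii_nonneg he.le fun t ht => ?_
      have := hmono heI (show t ∈ Ioo (0:ℝ) 1 from ⟨heI.1.trans ht.1, ht.2⟩) ht.1.le
      simp only at this
      linarith
  have hc'1 : c' < 1 := hc'c.trans_lt hcI.2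
  set b2 := ⨍ t in Icc c' 1, ψ t with hb2def
  have hpb2 : p b2 = p b := by
    rw [havg p (p b) c' 1 hc0 hc'1 le_rfl] at hN
    rcases mul_eq_zero.1 hN with h | h <;> linarith
  have hb2 : b2 ∈ Ω₁ := by
    apply G.mem1 hb hpb2
    set h := chord p q (ψ c) (ψ e) with hh
    set r := h (ψ e) with hr
    have e1 := havg h r c e hc.le hce he.le
    have e2 := havg h r c' 1 hc0 hc'1 le_rfl
    have s1 := intervalIntegral.integral_add_adjacent_intervals (b := c)
        (toII (hIl h r) hc0 hc'c hcI.2.le) (toII (hIl h r) hc.le hcI.2.le le_rfl)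
    have s2 := intervalIntegral.integral_add_adjacent_intervals (b := e)
        (toII (hIl h r) hc.le hce.le he.le) (toII (hIl h r) heI.1.le he.le le_rfl)
    have p1 : 0 ≤ ∫ t in c'..c, (h (ψ t) - r) := ii_nonneg hc'c fun t ht =>
      chord_nonneg_left G h0conv (hψ c) (hψ e).1 hlt (hψ t)
        (hmono ⟨hc0.trans_lt ht.1, ht.2.trans hcI.2⟩ hcI ht.2.le)
    have p3 : 0 ≤ ∫ t in e..1, (h (ψ t) - r) := ii_nonneg he.le fun t ht =>
      chord_nonneg_right G h0conv (hψ c) (hψ e) hlt (hψ t)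
        (hmono heI ⟨heI.1.trans ht.1, ht.2⟩ ht.1.le)
    have p2 : 0 ≤ ∫ t in c..e, -(h (ψ t) - r) := ii_nonneg hce.le fun t ht => by
      have htI : t ∈ Ioo (0:ℝ) 1 := ⟨hc.trans ht.1, ht.2.trans he⟩
      have := chord_nonpos_mid G h0conv (hψ c) (hψ e).1 hlt (hψ t) (hmono hcI htI ht.1.le)
        (hmono htI heI ht.2.le)
      rw [← hh, ← hr] at this
      linarith
    rw [intervalIntegral.integral_neg, e1] at p2
    rw [← hbdef] at e1 p2
    rw [← hb2def] at e2
    have hb0 : h b - r ≤ 0 := by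
      by_contra hcon
      push Not at hcon
      nlinarith [mul_pos (sub_pos.2 hce) hcon]
    have key : (1 - c') * (h b - r) ≤ (1 - c') * (h b2 - r) := by nlinarith
    have key2 : h b ≤ h b2 := by
      have := le_of_mul_le_mul_left key (by linarith)
      linarith
    rw [hh, chord_apply, chord_apply, hpb2] at key2
    have : (p (ψ e) - p (ψ c)) * q b ≤ (p (ψ e) - p (ψ c)) * q b2 := by linarith
    exact le_of_mul_le_mul_left this (by linarith)
  rcases eq_or_lt_of_le hc0 with h0 | h0
  · have h1 := clm_avg f ψ (c := 0) (e := 1) one_pos hI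
    rw [h1] at hfu
    rw [hb2def, ← h0] at hb2
    have := hf1 _ hb2
    linarith
  have hc'I : c' ∈ Ioo (0:ℝ) 1 := ⟨h0, hc'1⟩
  have hge : ∀ t ∈ Ioo c' 1, p (ψ c') ≤ p (ψ t) := fun t ht =>
    hmono hc'I ⟨h0.trans ht.1, ht.2⟩ ht.1.le
  have hp0 : p (ψ c') < p b2 := by
    have h1 := havg p (p (ψ c')) c' 1 hc0 hc'1 le_rfl
    rw [← hb2def] at h1
    have h2 : 0 ≤ ∫ t in c'..1, (p (ψ t) - p (ψ c')) := ii_nonneg hc'1.le fun t ht => by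
      linarith [hge t ht]
    have h3 : p (ψ c') ≤ p b2 := by
      rw [h1] at h2
      by_contra hcon
      push Not at hcon
      nlinarith [mul_pos (sub_pos.2 hc'1) (sub_pos.2 hcon)]
    refine lt_of_le_of_ne h3 fun heq => ?_
    rw [heq, sub_self, mul_zero, ← heq, intervalIntegral.integral_of_le hc'1.le,
      integral_Ioc_eq_integral_Ioo] at h1
    have h4 : (fun t => p (ψ t) - p (ψ c')) =ᵐ[volume.restrict (Ioo c' 1)] 0 := by
      refine (setIntegral_eq_zero_iff_of_nonneg_ae ?_ ?_).1 h1
      · refine (ae_restrict_iff' measurableSet_Ioo).2 (Filter.Eventually.of_forall fun t ht => ?_)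
        simpa using hge t ht
      · exact (hIl p _).mono_set (Ioo_subset_Icc_self.trans (Icc_subset_Icc hc0 le_rfl))
    have h5 : ∀ l : Euc 2 →L[ℝ] ℝ, l b2 = l (ψ c') := by
      intro l
      have h6 := havg l (l (ψ c')) c' 1 hc0 hc'1 le_rfl
      rw [← hb2def, intervalIntegral.integral_of_le hc'1.le, integral_Ioc_eq_integral_Ioo,
        integral_eq_zero_of_ae] at h6
      · rcases mul_eq_zero.1 h6.symm with h | h <;> linarith
      · filter_upwards [h4] with t ht
        simp only [Pi.zero_apply] at ht ⊢
        rw [G.inj (hψ t) (hψ c') (by linarith), sub_self]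
    have := G.eq (h5 p) (h5 q)
    exact hne b2 hb2 (this ▸ hψ c')
  -- pushing down
  obtain ⟨ε, hε, hb3⟩ : ∃ ε : ℝ, 0 < ε ∧ b2 - ε • v ∈ Ω₁ := by
    have hcont : Continuous fun ε : ℝ => b2 - ε • v := by fun_prop
    have hmem : {ε : ℝ | b2 - ε • v ∈ Ω₁} ∈ nhds (0:ℝ) :=
      (h1open.preimage hcont).mem_nhds (by simpa using hb2)
    obtain ⟨δ, hδ, hball⟩ := Metric.mem_nhds_iff.1 hmem
    exact ⟨δ / 2, by positivity, hball (by simp [abs_of_pos hδ]; linarith)⟩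
  set b3 := b2 - ε • v with hb3def
  have hp3 : p b3 = p b2 := by simp [hb3def, G.pv]
  have hq3 : q b3 = q b2 - ε := by simp [hb3def, G.qv]
  have hfin := hD2 (ψ c') (hψ c') b3 hb3 (by rw [hp3]; exact hp0) (by rw [hp3, hpb2]; exact hpb)
  have hTI : IntegrableOn (fun t => tchord p q (ψ c') b3 (ψ t)) (Icc 0 1) :=
    tchord_integrable _ ψ hI p q _ _
  rw [← intervalIntegral.integral_add_adjacent_intervals (b := c')
        (toII hTI le_rfl hc0 hc'1.le) (toII hTI hc0 hc'1.le le_rfl),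
      ii_congr (a := 0) (b := c') hc0 (h := fun _ => 0), ii_congr (a := c') (b := 1) hc'1.le
        (h := fun t => chord p q (ψ c') b3 (ψ t) - chord p q (ψ c') b3 b3),
      havg _ _ c' 1 hc0 hc'1 le_rfl, ← hb2def] at hfin
  · simp only [intervalIntegral.integral_zero, zero_add, chord_apply, hp3, hq3] at hfin
    have : (1 - c') * ((p b2 - p (ψ c')) * ε) ≤ 0 := by nlinarith
    have h2 : 0 < (1 - c') * ((p b2 - p (ψ c')) * ε) :=
      mul_pos (by linarith) (mul_pos (by linarith) hε)
    linarith
  · intro t ht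
    unfold tchord
    rcases eq_or_lt_of_le (hge t ht) with h | h
    · rw [indicator_of_notMem (by simp [h]), G.inj (hψ t) (hψ c') h.symm, chord_eq, sub_self]
    · rw [indicator_of_mem (show ψ t ∈ {z | p (ψ c') < p z} from h)]
  · intro t ht
    unfold tchord
    rw [indicator_of_notMem]
    have := hmono (show t ∈ Ioo (0:ℝ) 1 from ⟨ht.1, ht.2.trans hc'1⟩) hc'I ht.2.le
    simpa using this

theorem mix_facts (φs : ℕ → ℝ → Euc 2) (hI : ∀ k, IntegrableOn (φs k) (Icc 0 1))
    (α : ℕ → ℝ) (hα : ∀ k, 0 ≤ α k) (hsum : HasSum α 1) (M : ℝ)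
    (hM : ∀ k, ∫ t in Icc (0:ℝ) 1, ‖φs k t‖ ≤ M) (μ : Measure (Euc 2))
    (hμ : μ = Measure.sum (fun k => ENNReal.ofReal (α k) •
          Measure.map (φs k) (volume.restrict (Set.Icc (0:ℝ) 1)))) :
    IsProbabilityMeasure μ ∧ Integrable (fun z => z) μ ∧
    ∀ F : Euc 2 → ℝ, Measurable F → Integrable F μ →
      HasSum (fun k => α k * ∫ t in Icc (0:ℝ) 1, F (φs k t)) (∫ z, F z ∂μ) := by
  have hm : ∀ k, AEMeasurable (φs k) (volume.restrict (Icc (0:ℝ) 1)) := fun k =>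
    (hI k).1.aemeasurable
  have hs : ∑' k, ENNReal.ofReal (α k) = 1 := by
    rw [← ENNReal.ofReal_tsum_of_nonneg hα hsum.summable, hsum.tsum_eq, ENNReal.ofReal_one]
  have hprob : IsProbabilityMeasure μ := by
    constructor
    rw [hμ, Measure.sum_apply _ MeasurableSet.univ]
    rw [← hs]
    congr 1
    ext k
    rw [Measure.smul_apply, Measure.map_apply_of_aemeasurable (hm k) MeasurableSet.univ]
    simp
  refine ⟨hprob, ?_, ?_⟩
  · refine ⟨measurable_id.aestronglyMeasurable, ?_⟩
    unfold HasFiniteIntegral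
    rw [hμ, lintegral_sum_measure]
    have : ∀ k, ∫⁻ z : Euc 2, ‖z‖ₑ ∂(ENNReal.ofReal (α k) •
          Measure.map (φs k) (volume.restrict (Set.Icc (0:ℝ) 1))) ≤
          ENNReal.ofReal (α k) * ENNReal.ofReal M := by
      intro k
      rw [lintegral_smul_measure, lintegral_map' measurable_enorm.aemeasurable (hm k), smul_eq_mul]
      gcongr
      rw [← ofReal_integral_norm_eq_lintegral_enorm (hI k)]
      exact ENNReal.ofReal_le_ofReal (hM k)
    refine (ENNReal.tsum_le_tsum this).trans_lt ?_
    rw [ENNReal.tsum_mul_right, hs, one_mul]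
    exact ENNReal.ofReal_lt_top
  · intro F hF hFi
    rw [hμ] at hFi ⊢
    have := hasSum_integral_measure hFi
    have hfun : (fun k => α k * ∫ t in Icc (0:ℝ) 1, F (φs k t)) = fun k => ∫ z, F z ∂(ENNReal.ofReal (α k) •
          Measure.map (φs k) (volume.restrict (Set.Icc (0:ℝ) 1))) := by
      funext k
      rw [integral_smul_measure, integral_map (hm k) hF.aestronglyMeasurable,
        ENNReal.toReal_ofReal (hα k), smul_eq_mul]
    rw [hfun]
    exact this

theorem avg_shrink (Ω₁ : Set (Euc 2)) (h1open : IsOpen Ω₁) (ψ : ℝ → Euc 2)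
    (hI : IntegrableOn ψ (Icc 0 1)) {c e : ℝ} (hc : 0 ≤ c) (hce : c < e) (he : e ≤ 1)
    (h : (⨍ t in Icc c e, ψ t) ∈ Ω₁) :
    ∃ c' e', 0 < c' ∧ c' < e' ∧ e' < 1 ∧ (⨍ t in Icc c' e', ψ t) ∈ Ω₁ := by
  set ψ' := (Icc (0:ℝ) 1).indicator ψ with hψ'
  have hI' : Integrable ψ' := (integrable_indicator_iff measurableSet_Icc).2 hI
  set P : ℝ → Euc 2 := fun x => ∫ t in (0:ℝ)..x, ψ' t with hP
  have hPc : Continuous P := intervalIntegral.continuous_primitive (fun a b => hI'.intervalIntegrable) 0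
  have hav : ∀ a b, 0 ≤ a → a < b → b ≤ 1 → (⨍ t in Icc a b, ψ t) = (b - a)⁻¹ • (P b - P a) := by
    intro a b ha hab hb
    have hv : volume.real (Icc a b) = b - a := by simp [Measure.real, Real.volume_Icc, hab.le]
    rw [setAverage_eq, hv, hP]
    simp only
    rw [intervalIntegral.integral_interval_sub_left hI'.intervalIntegrable hI'.intervalIntegrable,
      intervalIntegral.integral_of_le hab.le, ← integral_Icc_eq_integral_Ioc]
    congr 1
    refine setIntegral_congr_fun measurableSet_Icc fun t ht => ?_
    rw [hψ', indicator_of_mem (show t ∈ Icc (0:ℝ) 1 from ⟨ha.trans ht.1, ht.2.trans hb⟩)]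
  have hg : ContinuousAt (fun δ : ℝ => ((e - δ) - (c + δ))⁻¹ • (P (e - δ) - P (c + δ))) 0 := by
    refine ContinuousAt.smul (ContinuousAt.inv₀ (f := fun δ : ℝ => (e - δ) - (c + δ)) (by fun_prop) ?_) ?_
    · simp; linarith
    · exact (by fun_prop : Continuous fun δ : ℝ => P (e - δ) - P (c + δ)).continuousAt
  have h0 : ((e - 0) - (c + 0))⁻¹ • (P (e - 0) - P (c + 0)) ∈ Ω₁ := by
    rw [hav c e hc hce he] at h
    simpa using h
  have hev : ∀ᶠ δ in nhds (0:ℝ), ((e - δ) - (c + δ))⁻¹ • (P (e - δ) - P (c + δ)) ∈ Ω₁ :=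
    hg.eventually (h1open.mem_nhds h0)
  have hev2 : ∀ᶠ δ in nhdsWithin (0:ℝ) (Ioi 0), δ ∈ Ioo 0 ((e - c) / 2) :=
    Ioo_mem_nhdsGT (by linarith)
  obtain ⟨δ, hδ, hδ1, hδ2⟩ := ((hev.filter_mono nhdsWithin_le_nhds).and hev2).exists
  refine ⟨c + δ, e - δ, by linarith, by linarith, by linarith, ?_⟩
  rw [hav _ _ (by linarith) (by linarith) (by linarith)]
  exact hδ

theorem avg_refl (ψ : ℝ → Euc 2) {c e : ℝ} (hce : c < e) :
    (⨍ t in Icc (1 - e) (1 - c), ψ (1 - t)) = ⨍ t in Icc c e, ψ t := by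
  have hv : ∀ a b : ℝ, a < b → volume.real (Icc a b) = b - a := fun a b hab => by
    simp [Measure.real, Real.volume_Icc, hab.le]
  rw [setAverage_eq, setAverage_eq, hv _ _ hce, hv _ _ (by linarith), integral_Icc_eq_integral_Ioc,
    integral_Icc_eq_integral_Ioc, ← intervalIntegral.integral_of_le (by linarith),
    ← intervalIntegral.integral_of_le hce.le, intervalIntegral.integral_comp_sub_left (fun t => ψ t)]
  congr 1
  · congr 1; ring
  · congr 1 <;> ring

/-- **Concatenation.** Let `Ω = cl Ω₀ \ Ω₁` satisfy conditions (1) and (3).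
Let `(φ_k)` be a sequence in `A_Ω` (on `[0,1]`) whose averages have bounded convex hull
contained in `Ω`, and let `(α_k)` be non-negative numbers with `∑ α_k = 1`. Then there is
`φ ∈ A_Ω` whose distribution is `∑_k α_k μ_{φ_k}`. -/
theorem stmt15 (Ω₀ Ω₁ : Set (Euc 2)) (h0ne : Ω₀.Nonempty) (h0open : IsOpen Ω₀)
    (h0conv : Convex ℝ Ω₀) (h0line : ContainsNoLine Ω₀)
    (h1open : IsOpen Ω₁) (h1conv : Convex ℝ Ω₁) (h1cl : closure Ω₁ ⊆ Ω₀)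
    (h1 : Cond1 Ω₀ Ω₁) (h3 : Cond3 Ω₀ Ω₁)
    (φs : ℕ → ℝ → Euc 2) (hφs : ∀ k, classA Ω₀ Ω₁ 0 1 (φs k))
    (hbdd : Bornology.IsBounded
      (convexHull ℝ (Set.range fun k => ⨍ t in Set.Icc (0:ℝ) 1, φs k t ∂volume)))
    (hsub : convexHull ℝ (Set.range fun k => ⨍ t in Set.Icc (0:ℝ) 1, φs k t ∂volume) ⊆
      closure Ω₀ \ Ω₁)
    (α : ℕ → ℝ) (hα : ∀ k, 0 ≤ α k) (hsum : ∑' k, α k = 1) :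
    ∃ φ : ℝ → Euc 2, Measurable φ ∧ classA Ω₀ Ω₁ 0 1 φ ∧
      Measure.map φ (volume.restrict (Set.Icc (0:ℝ) 1)) =
        Measure.sum (fun k => ENNReal.ofReal (α k) •
          Measure.map (φs k) (volume.restrict (Set.Icc (0:ℝ) 1))) := by
  have hS : HasSum α 1 := by
    have : Summable α := by
      by_contra h
      rw [tsum_eq_zero_of_not_summable h] at hsum
      exact zero_ne_one hsum
    rw [← hsum]
    exact this.hasSum
  obtain ⟨p, q, v, w, G⟩ := exists_geo Ω₀ Ω₁ h0ne h0open h0conv h0line h1open h1conv h1 h3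
  obtain ⟨l, C, K, hK, hctrl⟩ := exists_ctrl Ω₀ h0ne h0open h0conv h0line
  set x : ℕ → Euc 2 := fun k => ⨍ t in Set.Icc (0:ℝ) 1, φs k t ∂volume with hx
  have hxm : ∀ k, x k ∈ convexHull ℝ (Set.range x) := fun k =>
    subset_convexHull ℝ _ (mem_range_self k)
  have hl : ∀ (g : Euc 2 →L[ℝ] ℝ) k, ∫ t in Icc (0:ℝ) 1, g (φs k t) = g (x k) := by
    intro g k
    have := clm_avg g (φs k) (c := 0) (e := 1) one_pos (hφs k).1
    rw [intervalIntegral.integral_of_le zero_le_one, ← integral_Icc_eq_integral_Ioc] at this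
    rw [this]
    simp [hx]
  obtain ⟨R, hR⟩ := hbdd.exists_norm_le
  have hM : ∀ k, ∫ t in Icc (0:ℝ) 1, ‖φs k t‖ ≤ K * (C + ‖l‖ * R) := by
    intro k
    have hi : IntegrableOn (fun t => l (φs k t)) (Icc (0:ℝ) 1) := l.integrable_comp (hφs k).1
    have h1 : ∫ t in Icc (0:ℝ) 1, ‖φs k t‖ ≤ ∫ t in Icc (0:ℝ) 1, K * (C - l (φs k t)) := by
      refine setIntegral_mono_on (hφs k).1.norm ?_ measurableSet_Icc fun t ht =>
        hctrl _ ((hφs k).2.1 t ht).1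
      exact ((integrable_const C).sub hi).const_mul K
    refine h1.trans ?_
    rw [integral_const_mul, integral_sub (integrable_const C) hi, hl l k]
    have h2 : |l (x k)| ≤ ‖l‖ * R :=
      (l.le_opNorm _).trans (mul_le_mul_of_nonneg_left (hR _ (hxm k)) (norm_nonneg _))
    have h3 := (abs_le.1 h2).1
    simp only [integral_const, measureReal_restrict_apply_univ, Real.volume_real_Icc, sub_zero]
    refine mul_le_mul_of_nonneg_left ?_ hK
    norm_num
    linarith
  set μ := Measure.sum (fun k => ENNReal.ofReal (α k) •
          Measure.map (φs k) (volume.restrict (Set.Icc (0:ℝ) 1))) with hμ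
  obtain ⟨hprob, hid, hHS⟩ := mix_facts φs (fun k => (hφs k).1) α hα hS _ hM μ hμ
  have hfr : ∀ᵐ z ∂μ, z ∈ frontier Ω₀ := by
    rw [hμ, Measure.ae_sum_iff' (p := fun z => z ∈ frontier Ω₀) isClosed_frontier.measurableSet]
    intro k
    refine Measure.ae_smul_measure ?_ _
    rw [ae_map_iff (p := fun z => z ∈ frontier Ω₀) (hφs k).1.1.aemeasurable isClosed_frontier.measurableSet]
    exact (ae_restrict_iff' measurableSet_Icc).2 (Filter.Eventually.of_forall (hφs k).2.1)
  obtain ⟨ψ, hψm, hψf, hmono, hlaw⟩ := exists_rearr G μ hfr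
  have hI : IntegrableOn ψ (Icc 0 1) := by
    have h := hid
    rw [← hlaw] at h
    exact (integrable_map_measure measurable_id.aestronglyMeasurable hψm.aemeasurable).1 h
  have hlaw2 : ∀ F : Euc 2 → ℝ, Measurable F → ∫ t in (0:ℝ)..1, F (ψ t) = ∫ z, F z ∂μ := by
    intro F hF
    rw [intervalIntegral.integral_of_le zero_le_one, ← integral_Icc_eq_integral_Ioc, ← hlaw,
      integral_map hψm.aemeasurable hF.aestronglyMeasurable]
  have hlin : ∀ g : Euc 2 →L[ℝ] ℝ, HasSum (fun k => α k * g (x k)) (∫ t in (0:ℝ)..1, g (ψ t)) := by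
    intro g
    rw [hlaw2 g g.continuous.measurable]
    have := hHS g g.continuous.measurable (g.integrable_comp hid)
    simpa only [hl] using this
  obtain ⟨f, u, hf1, hf2⟩ := geometric_hahn_banach_open h1conv h1open (convex_convexHull ℝ (range x))
    (Set.disjoint_left.2 fun z hz hz2 => (hsub hz2).2 hz)
  have hfx : ∀ k, u ≤ f (x k) := fun k => hf2 _ (hxm k)
  have hfu : u ≤ ∫ t in (0:ℝ)..1, f (ψ t) := by
    have := hasSum_le (fun k => mul_le_mul_of_nonneg_left (hfx k) (hα k)) (hS.mul_right u) (hlin f)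
    simpa using this
  have hD2 : ∀ (p q : Euc 2 →L[ℝ] ℝ) (v w : Euc 2), Geo Ω₀ Ω₁ p q v w →
      ∀ y ∈ frontier Ω₀, ∀ b ∈ Ω₁, p y < p b → (∫ t in (0:ℝ)..1, p (ψ t)) ≤ p b →
      ∫ t in (0:ℝ)..1, tchord p q y b (ψ t) ≤ 0 := by
    intro p q v w G y hy b hb hyb hT
    rw [hlaw2 _ (tchord_meas p q y b)]
    have hC := hHS _ (tchord_meas p q y b) (tchord_integrable μ _ hid p q y b)
    exact sum_arg G hb hyb x _ α hα hS f u hf1 hfx _ _ (hlin p) hT hC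
      (fun k => (per_k G h0conv h1cl hy hb hyb (φs k) (hφs k)).1)
      (fun k => (per_k G h0conv h1cl hy hb hyb (φs k) (hφs k)).2)
  refine ⟨ψ, hψm, ⟨hI, fun t _ => hψf t, ?_⟩, hlaw⟩
  intro c0 e0 hc0 hce0 he0 hbad0
  obtain ⟨c, e, hc, hce, he, hbad⟩ := avg_shrink Ω₁ h1open ψ hI hc0 hce0 he0 hbad0
  rcases le_total (∫ t in (0:ℝ)..1, p (ψ t)) (p (⨍ t in Icc c e, ψ t)) with h | h
  · exact no_bad G h0open h0conv h1open h1cl ψ hψf hmono hI (hD2 p q v w G) f u hf1 hfu hc hce he hbad h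
  · have href : ∀ F : Euc 2 → ℝ, ∫ t in (0:ℝ)..1, F (ψ (1 - t)) = ∫ t in (0:ℝ)..1, F (ψ t) := by
      intro F
      rw [intervalIntegral.integral_comp_sub_left (fun t => F (ψ t))]
      simp
    have hav := avg_refl ψ hce
    refine no_bad G.neg h0open h0conv h1open h1cl (fun t => ψ (1 - t)) (fun t => hψf _) ?_ ?_ ?_
      f u hf1 ?_ (c := 1 - e) (e := 1 - c) (by linarith) (by linarith) (by linarith) ?_ ?_
    · intro s hs t ht hst
      have := hmono (show 1 - t ∈ Ioo (0:ℝ) 1 from ⟨by linarith [ht.2], by linarith [ht.1]⟩)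
        (show 1 - s ∈ Ioo (0:ℝ) 1 from ⟨by linarith [hs.2], by linarith [hs.1]⟩) (by linarith)
      simpa using this
    · have h1 := (intervalIntegrable_iff_integrableOn_Icc_of_le zero_le_one).2 hI
      have h2 := h1.comp_sub_left 1
      rw [sub_zero, sub_self] at h2
      exact (intervalIntegrable_iff_integrableOn_Icc_of_le zero_le_one).1 h2.symm
    · intro y hy b hb hyb hT
      rw [href (fun z => tchord (-p) q y b z)]
      rw [href (fun z => (-p) z)] at hT
      exact hD2 _ _ _ _ G.neg y hy b hb hyb hT
    · rw [href (fun z => f z)]; exact hfu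
    · rw [hav]; exact hbad
    · rw [hav, href (fun z => (-p) z)]
      simp only [neg_apply, intervalIntegral.integral_neg]
      linarith
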